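/- arXiv:1111.5657 — 2 statements merged into one kernel-verified Lean document; each statement's English description precedes it below -/
import Mathlib

section
/- Let p be a prime, r ≥ 1 an integer, q = p^r, and let k be a field of characteristic p. Let e be a natural number with e < q − 1. Then for every polynomial f ∈ k[t] of degree at most e and every integer j ≥ 1, the coefficient of t^{j·q − 1} in f^{q+1} is equal to 0. -/
open Polynomial in
theorem coeff_pow_char_pow_eq_zero_of_not_dvd {R : Type*} [CommSemiring R] {p : ℕ} [ExpChar R p]
    (f : R[X]) {r n : ℕ} (hn : ¬ p ^ r ∣ n) : (f ^ p ^ r).coeff n = 0 := by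
  rw [← map_iterateFrobenius_expand (p := p), coeff_map,
    coeff_expand (pow_pos (expChar_pos R p) r), if_neg hn, map_zero]

theorem stmt_0 (p r : ℕ) (hp : p.Prime) (hr : 1 ≤ r) (q : ℕ) (hq : q = p ^ r)
    (k : Type*) [Field k] [CharP k p] (e : ℕ) (he : e < q - 1)
    (f : Polynomial k) (hf : f.degree ≤ (e : ℕ)) (j : ℕ) (hj : 1 ≤ j) :
    (f ^ (q + 1)).coeff (j * q - 1) = 0 := by
  have : ExpChar k p := ExpChar.prime hp
  rw [pow_succ, Polynomial.coeff_mul]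
  refine Finset.sum_eq_zero fun ⟨a, b⟩ hab => ?_
  rw [Finset.HasAntidiagonal.mem_antidiagonal] at hab
  dsimp only at hab ⊢
  by_cases ha : q ∣ a
  · have hjq : q ≤ j * q := Nat.le_mul_of_pos_left q hj
    have hb : q ∣ b + 1 := by
      rw [← Nat.dvd_add_right ha, show a + (b + 1) = j * q by omega]
      exact dvd_mul_left q j
    have hqb : q ≤ b + 1 := Nat.le_of_dvd b.succ_pos hb
    have heb : e < b := by omega
    rw [Polynomial.coeff_eq_zero_of_degree_lt (hf.trans_lt (by exact_mod_cast heb)), mul_zero]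
  · subst hq
    rw [coeff_pow_char_pow_eq_zero_of_not_dvd f ha, zero_mul]
end

section
/- Let p be a prime, r ≥ 1 an integer, q = p^r, and let k be a field of characteristic p. Let N ≥ 1 and let e be a natural number with e < q − 1. Then for any polynomials f_0, f_1, …, f_N ∈ k[t], each of degree at most e, the polynomial F = Σ_{i=0}^{N} f_i^{q+1} has degree at most (q+1)·e and satisfies: for every integer j with 1 ≤ j ≤ e, the coefficient of t^{j·q − 1} in F is 0. -/
/-- In characteristic `p`, the exponents occurring in `f ^ p ^ r` are multiples of `p ^ r`. -/
theorem Polynomial.coeff_pow_char_pow_eq_zero {R : Type*} [CommSemiring R] (p r : ℕ) [ExpChar R p]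
    (f : Polynomial R) {n : ℕ} (hn : ¬ p ^ r ∣ n) : (f ^ p ^ r).coeff n = 0 := by
  rw [← Polynomial.map_iterateFrobenius_expand p f r, Polynomial.coeff_map,
    Polynomial.coeff_expand (expChar_pow_pos R p r), if_neg hn, map_zero]

/-- In characteristic `p`, if `q = p ^ r` and `deg f < q - 1`, then no exponent congruent to `-1`
modulo `q` occurs in `f ^ (q + 1)`. -/
theorem Polynomial.coeff_pow_char_pow_add_one_eq_zero {R : Type*} [CommSemiring R] (p r : ℕ)
    [ExpChar R p] (f : Polynomial R) (hf : f.natDegree < p ^ r - 1) {n : ℕ} (hn : p ^ r ∣ n + 1) :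
    (f ^ (p ^ r + 1)).coeff n = 0 := by
  rw [pow_succ, Polynomial.coeff_mul]
  refine Finset.sum_eq_zero fun ⟨a, b⟩ hab => ?_
  rw [Finset.HasAntidiagonal.mem_antidiagonal] at hab
  by_cases ha : p ^ r ∣ a
  · have hb : p ^ r ∣ b + 1 := (Nat.dvd_add_right ha).mp (by rwa [← add_assoc, hab])
    have hle := Nat.le_of_dvd b.succ_pos hb
    rw [Polynomial.coeff_eq_zero_of_natDegree_lt (show f.natDegree < b by omega), mul_zero]
  · rw [Polynomial.coeff_pow_char_pow_eq_zero p r f ha, zero_mul]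

theorem stmt_1 (p r : ℕ) (hp : p.Prime) (hr : 1 ≤ r) (q : ℕ) (hq : q = p ^ r)
    (k : Type*) [Field k] [CharP k p] (N : ℕ) (hN : 1 ≤ N)
    (e : ℕ) (he : e < q - 1)
    (f : Fin (N + 1) → Polynomial k) (hf : ∀ i, (f i).degree ≤ (e : ℕ))
    (F : Polynomial k) (hF : F = ∑ i : Fin (N + 1), (f i) ^ (q + 1)) :
    F.degree ≤ ((q + 1) * e : ℕ) ∧
      ∀ j : ℕ, 1 ≤ j → j ≤ e → F.coeff (j * q - 1) = 0 := by
  subst hF hq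
  have hf' (i) : (f i).natDegree ≤ e := Polynomial.natDegree_le_of_degree_le (hf i)
  refine ⟨Polynomial.degree_le_of_natDegree_le <| Polynomial.natDegree_sum_le_of_forall_le _ _
    fun i _ => Polynomial.natDegree_pow_le_of_le _ (hf' i), fun j hj _ => ?_⟩
  have : ExpChar k p := ExpChar.prime hp
  rw [Polynomial.finsetSum_coeff]
  refine Finset.sum_eq_zero fun i _ =>
    Polynomial.coeff_pow_char_pow_add_one_eq_zero p r (f i) ((hf' i).trans_lt he) ?_
  rw [Nat.sub_add_cancel (Nat.mul_pos hj (pow_pos hp.pos r))]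
  exact dvd_mul_left _ _
end
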